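/- Let n ≥ 0 and let (A^{•,•}, ∂, ∂̄) be a bounded double complex of finite-dimensional vector spaces over ℂ equipped with a real structure, such that A^{p,q} = 0 unless 0 ≤ p ≤ n and 0 ≤ q ≤ n. Then for every k ∈ ℤ: Σ_{p+q=k} dim_ℂ H_BC^{p,q} ≤ min{k+1, (2n−k)+1} · ( Σ_{p+q=k} dim_ℂ H_∂̄^{p,q} + Σ_{p+q=k−1} dim_ℂ H_∂̄^{p,q} ), and in particular the left-hand side is ≤ (n+1) · ( Σ_{p+q=k} dim_ℂ H_∂̄^{p,q} + Σ_{p+q=k−1} dim_ℂ H_∂̄^{p,q} ). (Upper bound for the Bott-Chern numbers in terms of the Hodge numbers, Angella–Tardini.) -/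

import Mathlib

open LinearMap Submodule Module DirectSum

namespace Paper

section DoubleComplex

variable (K : Type) [Field K]
variable (A : ℤ → ℤ → Type) [∀ p q, AddCommGroup (A p q)] [∀ p q, Module K (A p q)]

/-- Transport along equalities of the indices. -/
def dcCast {p q p' q' : ℤ} (h1 : p = p') (h2 : q = q') : A p q ≃ₗ[K] A p' q' := by
  subst h1; subst h2; exact LinearEquiv.refl K (A p q)

variable (d1 : ∀ p q : ℤ, A p q →ₗ[K] A (p + 1) q)
variable (d2 : ∀ p q : ℤ, A p q →ₗ[K] A p (q + 1))

/-- The operator ∂∂̄ : A^{p,q} → A^{p+1,q+1} (apply ∂̄ first, then ∂). -/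
def ddBar (p q : ℤ) : A p q →ₗ[K] A (p + 1) (q + 1) := (d1 p (q + 1)).comp (d2 p q)

/-- The image ∂∂̄(A^{p-1,q-1}) inside A^{p,q}. -/
def ddBarIm (p q : ℤ) : Submodule K (A p q) :=
  range ((dcCast K A (show p - 1 + 1 = p by ring) (show q - 1 + 1 = q by ring)).toLinearMap.comp
    (ddBar K A d1 d2 (p - 1) (q - 1)))

/-- Bott-Chern cohomology H_BC^{p,q} = (ker ∂ ∩ ker ∂̄)/∂∂̄(A^{p-1,q-1}). -/
abbrev HBC (p q : ℤ) :=
  ↥(ker (d1 p q) ⊓ ker (d2 p q)) ⧸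
    ((ddBarIm K A d1 d2 p q).comap (ker (d1 p q) ⊓ ker (d2 p q)).subtype)

noncomputable def hBC (p q : ℤ) : ℕ := finrank K (HBC K A d1 d2 p q)

/-- ∂(A^{p-1,q}) + ∂̄(A^{p,q-1}) inside A^{p,q}. -/
def aDen (p q : ℤ) : Submodule K (A p q) :=
  range ((dcCast K A (show p - 1 + 1 = p by ring) rfl).toLinearMap.comp (d1 (p - 1) q)) ⊔
  range ((dcCast K A rfl (show q - 1 + 1 = q by ring)).toLinearMap.comp (d2 p (q - 1)))

/-- Aeppli cohomology H_A^{p,q} = ker ∂∂̄ / (im ∂ + im ∂̄). -/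
abbrev HA (p q : ℤ) :=
  ↥(ker (ddBar K A d1 d2 p q)) ⧸ ((aDen K A d1 d2 p q).comap (ker (ddBar K A d1 d2 p q)).subtype)

noncomputable def hA (p q : ℤ) : ℕ := finrank K (HA K A d1 d2 p q)

/-- Column (Dolbeault) cohomology H_∂̄^{p,q}. -/
abbrev HDolb (p q : ℤ) :=
  ↥(ker (d2 p q)) ⧸
    ((range ((dcCast K A rfl (show q - 1 + 1 = q by ring)).toLinearMap.comp (d2 p (q - 1)))).comap
      (ker (d2 p q)).subtype)

noncomputable def hDolb (p q : ℤ) : ℕ := finrank K (HDolb K A d2 p q)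

/-- Row cohomology H_∂^{p,q}. -/
abbrev HRow (p q : ℤ) :=
  ↥(ker (d1 p q)) ⧸
    ((range ((dcCast K A (show p - 1 + 1 = p by ring) rfl).toLinearMap.comp (d1 (p - 1) q))).comap
      (ker (d1 p q)).subtype)

noncomputable def hRow (p q : ℤ) : ℕ := finrank K (HRow K A d1 p q)

/-- Total complex Tot^k = ⊕_{p+q=k} A^{p,q}. -/
abbrev Tot (k : ℤ) := ⨁ p : ℤ, A p (k - p)

/-- Total differential d = ∂ + ∂̄ on the total complex. -/
noncomputable def totD (k : ℤ) : Tot A k →ₗ[K] Tot A (k + 1) :=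
  DirectSum.toModule K ℤ (Tot A (k + 1)) fun p =>
    ((DirectSum.lof K ℤ (fun p' => A p' (k + 1 - p')) (p + 1)).comp
      ((dcCast K A rfl (show k - p = k + 1 - (p + 1) by ring)).toLinearMap.comp (d1 p (k - p))))
    +
    ((DirectSum.lof K ℤ (fun p' => A p' (k + 1 - p')) p).comp
      ((dcCast K A rfl (show k - p + 1 = k + 1 - p by ring)).toLinearMap.comp (d2 p (k - p))))

def totCast {k k' : ℤ} (h : k = k') : Tot A k ≃ₗ[K] Tot A k' := by
  subst h; exact LinearEquiv.refl K (Tot A k)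

/-- b_k = dim H^k(Tot, d). -/
noncomputable def bNum (k : ℤ) : ℕ :=
  finrank K
    (↥(ker (totD K A d1 d2 k)) ⧸
      ((range ((totCast K A (show k - 1 + 1 = k by ring)).toLinearMap.comp
        (totD K A d1 d2 (k - 1)))).comap (ker (totD K A d1 d2 k)).subtype))

/-- The ∂∂̄-lemma: ker ∂ ∩ ker ∂̄ ∩ (im ∂ + im ∂̄) ⊆ im ∂∂̄ in each bidegree. -/
def DDbarLemma : Prop :=
  ∀ p q : ℤ, (ker (d1 p q) ⊓ ker (d2 p q)) ⊓ aDen K A d1 d2 p q ≤ ddBarIm K A d1 d2 p q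

end DoubleComplex

/-- The map between sub-quotients induced by the identity. -/
def qMap (K : Type) [Field K] {V : Type} [AddCommGroup V] [Module K V]
    {N1 N2 M1 M2 : Submodule K V} (hN : N1 ≤ N2) (hM : M1 ≤ M2) :
    (↥N1 ⧸ M1.comap N1.subtype) →ₗ[K] (↥N2 ⧸ M2.comap N2.subtype) :=
  Submodule.mapQ _ _ (Submodule.inclusion hN) (by
    intro x hx
    simp only [Submodule.mem_comap, Submodule.coe_subtype] at hx ⊢
    simpa using hM hx)

section SComplex

variable (K : Type) [Field K]
variable (A : ℤ → Type) [∀ k, AddCommGroup (A k)] [∀ k, Module K (A k)]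

def sCast {k k' : ℤ} (h : k = k') : A k ≃ₗ[K] A k' := by
  subst h; exact LinearEquiv.refl K (A k)

variable (d : ∀ k : ℤ, A k →ₗ[K] A (k + 1))
variable (dl : ∀ k : ℤ, A k →ₗ[K] A (k - 1))

/-- The degree-0 operator dδ : A^k → A^k (apply δ first, then d). -/
def dDelta (k : ℤ) : A k →ₗ[K] A k :=
  (sCast K A (show k - 1 + 1 = k by ring)).toLinearMap.comp ((d (k - 1)).comp (dl k))

/-- Symplectic-type Bott-Chern cohomology H_BC^k = (ker d ∩ ker δ)/dδ(A^k). -/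
abbrev HBCs (k : ℤ) :=
  ↥(ker (d k) ⊓ ker (dl k)) ⧸
    ((range (dDelta K A d dl k)).comap (ker (d k) ⊓ ker (dl k)).subtype)

noncomputable def hBCs (k : ℤ) : ℕ := finrank K (HBCs K A d dl k)

/-- d(A^{k-1}) + δ(A^{k+1}) inside A^k. -/
def sDen (k : ℤ) : Submodule K (A k) :=
  range ((sCast K A (show k - 1 + 1 = k by ring)).toLinearMap.comp (d (k - 1))) ⊔
  range ((sCast K A (show k + 1 - 1 = k by ring)).toLinearMap.comp (dl (k + 1)))

/-- Symplectic-type Aeppli cohomology H_A^k = ker dδ / (im d + im δ). -/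
abbrev HAs (k : ℤ) :=
  ↥(ker (dDelta K A d dl k)) ⧸ ((sDen K A d dl k).comap (ker (dDelta K A d dl k)).subtype)

noncomputable def hAs (k : ℤ) : ℕ := finrank K (HAs K A d dl k)

/-- H_d^k = ker d / im d. -/
abbrev Hds (k : ℤ) :=
  ↥(ker (d k)) ⧸
    ((range ((sCast K A (show k - 1 + 1 = k by ring)).toLinearMap.comp (d (k - 1)))).comap
      (ker (d k)).subtype)

noncomputable def hds (k : ℤ) : ℕ := finrank K (Hds K A d k)

/-- H_δ^k = ker δ / im δ. -/
abbrev Hdls (k : ℤ) :=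
  ↥(ker (dl k)) ⧸
    ((range ((sCast K A (show k + 1 - 1 = k by ring)).toLinearMap.comp (dl (k + 1)))).comap
      (ker (dl k)).subtype)

noncomputable def hdls (k : ℤ) : ℕ := finrank K (Hdls K A dl k)

/-- The dδ-lemma: ker d ∩ ker δ ∩ (im d + im δ) ⊆ im dδ in each degree. -/
def DDeltaLemma : Prop :=
  ∀ k : ℤ, (ker (d k) ⊓ ker (dl k)) ⊓ sDen K A d dl k ≤ range (dDelta K A d dl k)

/-- The strip double complex B^{p,q} = A^{p-q}. -/
abbrev strip (p q : ℤ) := A (p - q)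

/-- ∂ on the strip double complex, given by d. -/
def stripD1 (p q : ℤ) : strip A p q →ₗ[K] strip A (p + 1) q :=
  (sCast K A (show p - q + 1 = p + 1 - q by ring)).toLinearMap.comp (d (p - q))

/-- ∂̄ on the strip double complex, given by δ. -/
def stripD2 (p q : ℤ) : strip A p q →ₗ[K] strip A p (q + 1) :=
  (sCast K A (show p - q - 1 = p - (q + 1) by ring)).toLinearMap.comp (dl (p - q))

end SComplex

/-- Dimension of a subquotient. -/
theorem finrank_subquotient_add {K V : Type} [Field K] [AddCommGroup V] [Module K V]
    [FiniteDimensional K V] {M M' N : Submodule K V} (e : M' = M) (h : M ≤ N) :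
    finrank K (↥N ⧸ M'.comap N.subtype) + finrank K M = finrank K N := by
  subst e
  rw [← (Submodule.comapSubtypeEquivOfLe h).finrank_eq]
  exact Submodule.finrank_quotient_add_finrank _

theorem finrank_map_add_finrank_inf_ker {K V W : Type} [Field K] [AddCommGroup V] [Module K V]
    [AddCommGroup W] [Module K W] [FiniteDimensional K V] (f : V →ₗ[K] W) (U : Submodule K V) :
    finrank K (U.map f) + finrank K ↥(U ⊓ ker f) = finrank K U := by
  have h := (f.domRestrict U).finrank_range_add_finrank_ker
  rw [LinearMap.range_domRestrict, LinearMap.ker_domRestrict] at h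
  rw [← h, ← Submodule.map_comap_subtype,
    (Submodule.equivMapOfInjective U.subtype U.injective_subtype _).finrank_eq]

/-- The dimension count behind the comparison of two neighbouring Bott-Chern groups: here `X` is the
space in degree `k - 1` mapping to `Z` by `f` and to `Y` by `g`. -/
theorem finrank_add_le_of_span {K V W X Y Z : Type} [Field K]
    [AddCommGroup V] [Module K V] [AddCommGroup W] [Module K W] [AddCommGroup X] [Module K X]
    [AddCommGroup Y] [Module K Y] [AddCommGroup Z] [Module K Z]
    [FiniteDimensional K X] [FiniteDimensional K Y] [FiniteDimensional K Z]
    (a : W →ₗ[K] X) (c : V →ₗ[K] X) (f : X →ₗ[K] Z) (g : X →ₗ[K] Y)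
    (hfa : range a ≤ ker f) (hgc : range c ≤ ker g)
    (KY DY : Submodule K Y) (KZ : Submodule K Z)
    (hKD : KY ≤ DY) (hgD : range g ≤ DY) (hS : KY.comap g = KZ.comap f) :
    finrank K KY + finrank K (range g) + finrank K (range a) + finrank K ((range c).map f) ≤
      finrank K DY + finrank K (ker f) + finrank K KZ + finrank K ((range a).map g) := by
  have hkerg : ker g ≤ KY.comap g := fun x hx => by
    rw [Submodule.mem_comap, LinearMap.mem_ker.1 hx]; exact zero_mem _
  have hkerf : ker f ≤ KY.comap g := fun x hx => by
    rw [hS, Submodule.mem_comap, LinearMap.mem_ker.1 hx]; exact zero_mem _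
  have h1 := Submodule.finrank_sup_add_finrank_inf_eq KY (range g)
  have h2 := Submodule.finrank_mono (sup_le hKD hgD)
  have h3 := finrank_map_add_finrank_inf_ker g (KY.comap g)
  rw [Submodule.map_comap_eq, inf_eq_right.2 hkerg, inf_comm] at h3
  have h4 := finrank_map_add_finrank_inf_ker f (KY.comap g)
  rw [inf_eq_right.2 hkerf] at h4
  have h5 : finrank K ((KY.comap g).map f) ≤ finrank K KZ :=
    Submodule.finrank_mono (by rw [hS]; exact Submodule.map_comap_le _ _)
  have h6 := finrank_map_add_finrank_inf_ker g (range a)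
  have h7 : finrank K ((range c).map f) ≤ finrank K ((ker g).map f) :=
    Submodule.finrank_mono (Submodule.map_mono hgc)
  have h8 := finrank_map_add_finrank_inf_ker f (ker g)
  have h9 : finrank K ↥(range a ⊓ ker g) ≤ finrank K ↥(ker g ⊓ ker f) :=
    Submodule.finrank_mono (by rw [inf_comm]; exact inf_le_inf_left _ hfa)
  omega

/-- A conjugate-linear bijection preserves dimensions of corresponding subspaces. -/
theorem finrank_eq_of_conj {V W : Type} [AddCommGroup V] [Module ℂ V] [AddCommGroup W] [Module ℂ W]
    (s : V →ₛₗ[starRingEnd ℂ] W) (t : W →ₛₗ[starRingEnd ℂ] V)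
    (hts : ∀ x, t (s x) = x) (hst : ∀ y, s (t y) = y)
    (N : Submodule ℂ V) (M : Submodule ℂ W)
    (hN : ∀ x ∈ N, s x ∈ M) (hM : ∀ y ∈ M, t y ∈ N) : finrank ℂ N = finrank ℂ M := by
  let e : N ≃+ M :=
    { toFun := fun x => ⟨s x, hN x x.2⟩
      invFun := fun y => ⟨t y, hM y y.2⟩
      left_inv := fun x => Subtype.ext (hts x)
      right_inv := fun y => Subtype.ext (hst y)
      map_add' := fun x y => Subtype.ext (map_add s (x : V) y) }
  have h := rank_eq_of_equiv_equiv (starRingEnd ℂ) e (star_involutive (R := ℂ)).bijective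
    (fun r x => Subtype.ext (LinearMap.map_smulₛₗ s r (x : V)))
  exact congrArg Cardinal.toNat h

section

variable (K : Type) [Field K]
variable (A : ℤ → ℤ → Type) [∀ p q, AddCommGroup (A p q)] [∀ p q, Module K (A p q)]
variable (d1 : ∀ p q : ℤ, A p q →ₗ[K] A (p + 1) q)
variable (d2 : ∀ p q : ℤ, A p q →ₗ[K] A p (q + 1))

theorem ddBarIm_add_one (p q : ℤ) :
    ddBarIm K A d1 d2 (p + 1) (q + 1) = range (ddBar K A d1 d2 p q) := by
  have key : ∀ (p' q' : ℤ) (hp : p' = p) (hq : q' = q) (h1 : p' + 1 = p + 1) (h2 : q' + 1 = q + 1),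
      range ((dcCast K A h1 h2).toLinearMap.comp (ddBar K A d1 d2 p' q')) =
        range (ddBar K A d1 d2 p q) := by
    rintro _ _ rfl rfl _ _; rfl
  exact key _ _ (by ring) (by ring) _ _

theorem range_d1_sub_one (p q : ℤ) (h : p + 1 - 1 + 1 = p + 1) :
    range ((dcCast K A h rfl).toLinearMap.comp (d1 (p + 1 - 1) q)) = range (d1 p q) := by
  have key : ∀ (p' : ℤ) (hp : p' = p) (h1 : p' + 1 = p + 1),
      range ((dcCast K A h1 rfl).toLinearMap.comp (d1 p' q)) = range (d1 p q) := by
    rintro _ rfl _; rfl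
  exact key _ (by ring) _

theorem range_d2_sub_one (p q : ℤ) (h : q + 1 - 1 + 1 = q + 1) :
    range ((dcCast K A rfl h).toLinearMap.comp (d2 p (q + 1 - 1))) = range (d2 p q) := by
  have key : ∀ (q' : ℤ) (hq : q' = q) (h1 : q' + 1 = q + 1),
      range ((dcCast K A rfl h1).toLinearMap.comp (d2 p q')) = range (d2 p q) := by
    rintro _ rfl _; rfl
  exact key _ (by ring) _

variable [∀ p q, FiniteDimensional K (A p q)]

theorem hRow_add_finrank (hd1d1 : ∀ (p q : ℤ) (x : A p q), d1 (p + 1) q (d1 p q x) = 0) (p q : ℤ) :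
    hRow K A d1 (p + 1) q + finrank K (range (d1 p q)) = finrank K (ker (d1 (p + 1) q)) := by
  exact finrank_subquotient_add (range_d1_sub_one K A d1 p q _)
    (by rintro _ ⟨x, rfl⟩; exact hd1d1 p q x)

theorem hDolb_add_finrank (hd2d2 : ∀ (p q : ℤ) (x : A p q), d2 p (q + 1) (d2 p q x) = 0)
    (p q : ℤ) :
    hDolb K A d2 p (q + 1) + finrank K (range (d2 p q)) = finrank K (ker (d2 p (q + 1))) := by
  exact finrank_subquotient_add (range_d2_sub_one K A d2 p q _)
    (by rintro _ ⟨x, rfl⟩; exact hd2d2 p q x)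

theorem hBC_add_finrank (hd1d1 : ∀ (p q : ℤ) (x : A p q), d1 (p + 1) q (d1 p q x) = 0)
    (hd2d2 : ∀ (p q : ℤ) (x : A p q), d2 p (q + 1) (d2 p q x) = 0)
    (hanti : ∀ (p q : ℤ) (x : A p q), d1 p (q + 1) (d2 p q x) + d2 (p + 1) q (d1 p q x) = 0)
    (p q : ℤ) :
    hBC K A d1 d2 (p + 1) (q + 1) + finrank K (range (ddBar K A d1 d2 p q)) =
      finrank K ↥(ker (d1 (p + 1) (q + 1)) ⊓ ker (d2 (p + 1) (q + 1))) := by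
  refine finrank_subquotient_add (ddBarIm_add_one K A d1 d2 p q) ?_
  rintro _ ⟨x, rfl⟩
  refine ⟨hd1d1 _ _ _, ?_⟩
  change d2 _ _ (d1 _ _ (d2 _ _ x)) = 0
  simpa [hd2d2] using hanti p (q + 1) (d2 p q x)

theorem hBC_le_of_add_one (hd1d1 : ∀ (p q : ℤ) (x : A p q), d1 (p + 1) q (d1 p q x) = 0)
    (hd2d2 : ∀ (p q : ℤ) (x : A p q), d2 p (q + 1) (d2 p q x) = 0)
    (hanti : ∀ (p q : ℤ) (x : A p q), d1 p (q + 1) (d2 p q x) + d2 (p + 1) q (d1 p q x) = 0)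
    (p q : ℤ) :
    hBC K A d1 d2 (p + 1) (q + 1 + 1) ≤
      hDolb K A d2 (p + 1) (q + 1 + 1) + hRow K A d1 (p + 1) (q + 1) +
        hBC K A d1 d2 (p + 1 + 1) (q + 1) := by
  have hY := hBC_add_finrank K A d1 d2 hd1d1 hd2d2 hanti p (q + 1)
  have hZ := hBC_add_finrank K A d1 d2 hd1d1 hd2d2 hanti (p + 1) q
  have hD := hDolb_add_finrank K A d2 hd2d2 (p + 1) (q + 1)
  have hR := hRow_add_finrank K A d1 hd1d1 p (q + 1)
  have hmain := finrank_add_le_of_span (d1 p (q + 1)) (d2 (p + 1) q) (d1 (p + 1) (q + 1))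
    (d2 (p + 1) (q + 1)) (by rintro _ ⟨x, rfl⟩; exact hd1d1 _ _ x)
    (by rintro _ ⟨x, rfl⟩; exact hd2d2 _ _ x)
    (ker (d1 (p + 1) (q + 1 + 1)) ⊓ ker (d2 (p + 1) (q + 1 + 1))) (ker (d2 (p + 1) (q + 1 + 1)))
    (ker (d1 (p + 1 + 1) (q + 1)) ⊓ ker (d2 (p + 1 + 1) (q + 1))) inf_le_right
    (by rintro _ ⟨x, rfl⟩; exact hd2d2 _ _ x)
    (by
      ext x
      have h := hanti (p + 1) (q + 1) x
      simp only [Submodule.mem_comap, Submodule.mem_inf, LinearMap.mem_ker, hd1d1, hd2d2, true_and,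
        and_true]
      constructor <;> intro h0 <;> simpa [h0] using h)
  have e1 : finrank K (range (ddBar K A d1 d2 (p + 1) q)) =
      finrank K ((range (d2 (p + 1) q)).map (d1 (p + 1) (q + 1))) := by
    rw [ddBar, LinearMap.range_comp]
  have e2 : finrank K (range (ddBar K A d1 d2 p (q + 1))) =
      finrank K ((range (d1 p (q + 1))).map (d2 (p + 1) (q + 1))) := by
    have : ddBar K A d1 d2 p (q + 1) = -((d2 (p + 1) (q + 1)).comp (d1 p (q + 1))) := by
      ext x; exact eq_neg_of_add_eq_zero_left (hanti p (q + 1) x)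
    rw [this, LinearMap.range_neg, LinearMap.range_comp]
  omega

end

theorem hRow_eq_hDolb_swap (A : ℤ → ℤ → Type)
    [∀ p q, AddCommGroup (A p q)] [∀ p q, Module ℂ (A p q)]
    [∀ p q, FiniteDimensional ℂ (A p q)]
    (d1 : ∀ p q : ℤ, A p q →ₗ[ℂ] A (p + 1) q)
    (d2 : ∀ p q : ℤ, A p q →ₗ[ℂ] A p (q + 1))
    (hd1d1 : ∀ (p q : ℤ) (x : A p q), d1 (p + 1) q (d1 p q x) = 0)
    (hd2d2 : ∀ (p q : ℤ) (x : A p q), d2 p (q + 1) (d2 p q x) = 0)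
    (σ : ∀ p q : ℤ, A p q →ₛₗ[starRingEnd ℂ] A q p)
    (hσσ : ∀ (p q : ℤ) (x : A p q), σ q p (σ p q x) = x)
    (hσd : ∀ (p q : ℤ) (x : A p q), σ (p + 1) q (d1 p q x) = d2 q p (σ p q x)) (p q : ℤ) :
    hRow ℂ A d1 p q = hDolb ℂ A d2 q p := by
  obtain ⟨p, rfl⟩ : ∃ r, p = r + 1 := ⟨p - 1, by ring⟩
  have hσd' : ∀ (p q : ℤ) (y : A q p), σ q (p + 1) (d2 q p y) = d1 p q (σ q p y) := fun p q y => by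
    rw [← hσσ q p y, ← hσd, hσσ, hσσ]
  have hR := hRow_add_finrank ℂ A d1 hd1d1 p q
  have hD := hDolb_add_finrank ℂ A d2 hd2d2 q p
  have hker : finrank ℂ (ker (d1 (p + 1) q)) = finrank ℂ (ker (d2 q (p + 1))) := by
    refine finrank_eq_of_conj (σ _ _) (σ _ _) (hσσ _ _) (hσσ _ _) _ _ ?_ ?_ <;> intro x hx <;>
      rw [LinearMap.mem_ker] at hx ⊢
    · rw [← hσd, hx, map_zero]
    · rw [← hσd', hx, map_zero]
  have hrange : finrank ℂ (range (d1 p q)) = finrank ℂ (range (d2 q p)) := by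
    refine finrank_eq_of_conj (σ _ _) (σ _ _) (hσσ _ _) (hσσ _ _) _ _ ?_ ?_ <;> rintro _ ⟨x, rfl⟩
    · exact ⟨σ p q x, (hσd p q x).symm⟩
    · exact ⟨σ q p x, (hσd' p q x).symm⟩
  omega

theorem bott_chern_upper_bound (n : ℕ)
    (A : ℤ → ℤ → Type) [∀ p q, AddCommGroup (A p q)] [∀ p q, Module ℂ (A p q)]
    [∀ p q, FiniteDimensional ℂ (A p q)]
    (d1 : ∀ p q : ℤ, A p q →ₗ[ℂ] A (p + 1) q)
    (d2 : ∀ p q : ℤ, A p q →ₗ[ℂ] A p (q + 1))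
    (hsupp : ∀ p q : ℤ, (p < 0 ∨ (n : ℤ) < p ∨ q < 0 ∨ (n : ℤ) < q) → Subsingleton (A p q))
    (hd1d1 : ∀ (p q : ℤ) (x : A p q), d1 (p + 1) q (d1 p q x) = 0)
    (hd2d2 : ∀ (p q : ℤ) (x : A p q), d2 p (q + 1) (d2 p q x) = 0)
    (hanti : ∀ (p q : ℤ) (x : A p q), d1 p (q + 1) (d2 p q x) + d2 (p + 1) q (d1 p q x) = 0)
    (σ : ∀ p q : ℤ, A p q →ₛₗ[starRingEnd ℂ] A q p)
    (hσσ : ∀ (p q : ℤ) (x : A p q), σ q p (σ p q x) = x)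
    (hσd : ∀ (p q : ℤ) (x : A p q), σ (p + 1) q (d1 p q x) = d2 q p (σ p q x)) :
    ∀ k : ℤ,
      ((∑ᶠ p : ℤ, hBC ℂ A d1 d2 p (k - p) : ℕ) : ℤ) ≤
        min (k + 1) (2 * (n : ℤ) - k + 1) *
          (((∑ᶠ p : ℤ, hDolb ℂ A d2 p (k - p) : ℕ) : ℤ) +
            ((∑ᶠ p : ℤ, hDolb ℂ A d2 p (k - 1 - p) : ℕ) : ℤ)) ∧
      ((∑ᶠ p : ℤ, hBC ℂ A d1 d2 p (k - p) : ℕ) : ℤ) ≤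
        ((n : ℤ) + 1) *
          (((∑ᶠ p : ℤ, hDolb ℂ A d2 p (k - p) : ℕ) : ℤ) +
            ((∑ᶠ p : ℤ, hDolb ℂ A d2 p (k - 1 - p) : ℕ) : ℤ)) := by
  intro k
  set D : ℤ → ℤ → ℕ := fun p q => hDolb ℂ A d2 p q with hDdef
  set F : ℤ → ℕ := fun p => hBC ℂ A d1 d2 p (k - p) with hF
  have hD0 : ∀ p q : ℤ, (p < 0 ∨ (n : ℤ) < p ∨ q < 0 ∨ (n : ℤ) < q) → D p q = 0 := fun p q h => by
    have := hsupp p q h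
    exact finrank_zero_of_subsingleton
  have hF0 : ∀ p : ℤ, (p < 0 ∨ (n : ℤ) < p ∨ k - p < 0 ∨ (n : ℤ) < k - p) → F p = 0 :=
    fun p h => by
      have := hsupp p (k - p) h
      exact finrank_zero_of_subsingleton
  have hstep : ∀ p : ℤ, F p ≤ D p (k - p) + D (k - 1 - p) p + F (p + 1) := fun p => by
    have h := hBC_le_of_add_one ℂ A d1 d2 hd1d1 hd2d2 hanti (p - 1) (k - p - 2)
    rw [hRow_eq_hDolb_swap A d1 d2 hd1d1 hd2d2 σ hσσ hσd, show p - 1 + 1 = p by ring,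
      show k - p - 2 + 1 = k - 1 - p by ring, show k - 1 - p + 1 = k - p by ring] at h
    simpa only [hF, hDdef, show k - (p + 1) = k - 1 - p by ring] using h
  have hsumD : ∀ l : ℤ, ∑ᶠ p : ℤ, D p (l - p) = ∑ p ∈ Finset.Icc (0 : ℤ) n, D p (l - p) :=
    fun l => finsum_eq_sum_of_support_subset _ fun p hp => by
      by_contra hp'
      simp only [Finset.coe_Icc, Set.mem_Icc] at hp'
      exact hp (hD0 p (l - p) (by omega))
  have hsumD' : ∑ᶠ p : ℤ, D p (k - 1 - p) = ∑ p ∈ Finset.Icc (0 : ℤ) n, D (k - 1 - p) p := by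
    rw [← finsum_comp_equiv (Equiv.subLeft (k - 1))]
    simp only [Equiv.subLeft_apply, sub_sub_cancel]
    refine finsum_eq_sum_of_support_subset _ fun p hp => ?_
    by_contra hp'
    simp only [Finset.coe_Icc, Set.mem_Icc] at hp'
    exact hp (hD0 (k - 1 - p) p (by omega))
  set T : ℕ := ∑ᶠ p : ℤ, D p (k - p) + ∑ᶠ p : ℤ, D p (k - 1 - p) with hT
  have hTsum : T = ∑ p ∈ Finset.Icc (0 : ℤ) n, (D p (k - p) + D (k - 1 - p) p) := by
    rw [hT, hsumD, hsumD', Finset.sum_add_distrib]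
  have htail : ∀ p : ℤ, p ≤ n + 1 →
      F p ≤ ∑ j ∈ Finset.Icc p (n : ℤ), (D j (k - j) + D (k - 1 - j) j) := fun p hp => by
    induction p, hp using Int.leInductionDown with
    | base => rw [hF0 _ (by omega)]; exact Nat.zero_le _
    | pred p hp ih =>
      have hI : Finset.Icc (p - 1) (n : ℤ) = insert (p - 1) (Finset.Icc p n) := by
        ext j; simp only [Finset.mem_Icc, Finset.mem_insert]; omega
      rw [hI, Finset.sum_insert (by simp)]
      have h := hstep (p - 1)
      rw [sub_add_cancel] at h
      omega
  have hFT : ∀ p : ℤ, F p ≤ T := fun p => by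
    by_cases hp : 0 ≤ p ∧ p ≤ n
    · rw [hTsum]
      exact (htail p (by omega)).trans
        (Finset.sum_le_sum_of_subset (Finset.Icc_subset_Icc_left hp.1))
    · rw [hF0 p (by omega)]; exact Nat.zero_le _
  have hsumF : ∑ᶠ p : ℤ, F p ≤ (min (n : ℤ) k + 1 - max 0 (k - n)).toNat * T := by
    rw [finsum_eq_sum_of_support_subset (s := Finset.Icc (max 0 (k - n)) (min (n : ℤ) k))]
    · refine (Finset.sum_le_card_nsmul _ _ _ fun p _ => hFT p).trans ?_
      rw [Int.card_Icc, smul_eq_mul]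
    · intro p hp
      by_contra hp'
      simp only [Finset.coe_Icc, Set.mem_Icc] at hp'
      exact hp (hF0 p (by omega))
  have hT0 : k < 0 ∨ 2 * (n : ℤ) + 1 < k → T = 0 := fun h => by
    rw [hTsum]
    refine Finset.sum_eq_zero fun p _ => ?_
    rw [hD0 p (k - p) (by omega), hD0 (k - 1 - p) p (by omega), add_zero]
  rw [← Nat.cast_add, ← hT]
  have hsumF' : ((∑ᶠ p : ℤ, F p : ℕ) : ℤ) ≤
      ((min (n : ℤ) k + 1 - max 0 (k - n)).toNat : ℤ) * (T : ℤ) := by exact_mod_cast hsumF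
  have hTnn : (0 : ℤ) ≤ T := Int.natCast_nonneg T
  by_cases hk : k < 0 ∨ 2 * (n : ℤ) + 1 < k
  · rw [hT0 hk] at hsumF' ⊢
    simpa using hsumF'
  · exact ⟨hsumF'.trans (mul_le_mul_of_nonneg_right (by omega) hTnn),
      hsumF'.trans (mul_le_mul_of_nonneg_right (by omega) hTnn)⟩

end Paper
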